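/- arXiv:2007.11440 — 9 statements merged into one kernel-verified Lean document; each statement's English description precedes it below -/
import Mathlib

section
/- Let K be a number field and let P be a nonempty set of height-one primes of its ring of integers. Let R = ∏_{v ∈ P} O_v be the product of the rings of v-adic integers. Then there exists a finite subset S of R such that every element r of R can be written as r = ξ² − η² + s for some units ξ, η of R and some s ∈ S. -/
open IsDedekindDomain NumberField

/-- In a local ring where `2, 3, 5` are units every element is a difference of two unit squares. -/
theorem sLemma_good {A : Type*} [CommRing A] [IsLocalRing A] (h : IsUnit (30 : A)) (r : A) :
    ∃ x y : Aˣ, r = (x : A) ^ 2 - (y : A) ^ 2 := by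
  have h2 : IsUnit (2 : A) := isUnit_of_dvd_unit ⟨15, by norm_num⟩ h
  have h3 : IsUnit (3 : A) := isUnit_of_dvd_unit ⟨10, by norm_num⟩ h
  have h5 : IsUnit (5 : A) := isUnit_of_dvd_unit ⟨6, by norm_num⟩ h
  -- it suffices to find a unit `u` with `r + u ^ 2` and `r - u ^ 2` units
  have key : ∀ u : Aˣ, IsUnit (r + (u : A) ^ 2) → IsUnit (r - (u : A) ^ 2) →
      ∃ x y : Aˣ, r = (x : A) ^ 2 - (y : A) ^ 2 := by
    rintro u ⟨a, ha⟩ ⟨b, hb⟩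
    obtain ⟨t, ht⟩ := h2
    have e1 : (u : A) * ((u⁻¹ : Aˣ) : A) = 1 := u.mul_inv
    have e2 : (2 : A) * ((t⁻¹ : Aˣ) : A) = 1 := by rw [← ht]; exact t.mul_inv
    refine ⟨a * u⁻¹ * t⁻¹, b * u⁻¹ * t⁻¹, ?_⟩
    push_cast
    rw [ha, hb]
    generalize ((u⁻¹ : Aˣ) : A) = w at *
    generalize ((t⁻¹ : Aˣ) : A) = z at *
    generalize (u : A) = u at *
    have e3 : (u * w) ^ 2 = 1 := by rw [e1]; ring
    have e4 : (2 * z) ^ 2 = 1 := by rw [e2]; ring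
    linear_combination (-r) * e3 - r * (u * w) ^ 2 * e4
  have dich : ∀ a b : A, IsUnit (a - b) → ¬ IsUnit a → IsUnit b := by
    intro a b hab ha
    by_contra hb
    exact (IsLocalRing.mem_maximalIdeal _).1
      (sub_mem ((IsLocalRing.mem_maximalIdeal _).2 ha) ((IsLocalRing.mem_maximalIdeal _).2 hb)) hab
  obtain ⟨t, ht⟩ := h2
  by_cases hp : IsUnit (r + 1)
  · by_cases hm : IsUnit (r - 1)
    · exact key 1 (by simpa using hp) (by simpa using hm)
    · refine key t ?_ ?_
      · refine dich _ _ ?_ hm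
        rw [ht]; convert h5.neg using 1; ring
      · refine dich _ _ ?_ hm
        rw [ht]; convert h3 using 1; ring
  · refine key t ?_ ?_
    · refine dich _ _ ?_ hp
      rw [ht]; convert h3.neg using 1; ring
    · refine dich _ _ ?_ hp
      rw [ht]; convert h5 using 1; ring

/-- At any place the classes of differences of two unit squares can be adjusted by finitely many
elements. -/
theorem sLemma_bad (K : Type*) [Field K] [NumberField K] (v : HeightOneSpectrum (𝓞 K)) :
    ∃ S : Set (v.adicCompletionIntegers K), S.Finite ∧ ∀ r : v.adicCompletionIntegers K,
      ∃ x y : (v.adicCompletionIntegers K)ˣ, ∃ s ∈ S,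
        r = (x : v.adicCompletionIntegers K) ^ 2 - (y : v.adicCompletionIntegers K) ^ 2 + s := by
  set I : Ideal (𝓞 K) := Ideal.span {4} * v.asIdeal with hI
  have hI0 : I ≠ ⊥ := mul_ne_zero (by simp) v.ne_bot
  have : Finite (𝓞 K ⧸ I) := I.finiteQuotientOfFreeOfNeBot hI0
  refine ⟨Set.range fun q : 𝓞 K ⧸ I => algebraMap (𝓞 K) (v.adicCompletionIntegers K) q.out,
    Set.finite_range _, fun r => ?_⟩
  have h40 : (4 : v.adicCompletion K) ≠ 0 := by
    have : (algebraMap K (v.adicCompletion K)) 4 ≠ 0 := (map_ne_zero _).2 (by norm_num)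
    rwa [map_ofNat] at this
  set γ : WithZero (Multiplicative ℤ) := Valued.v (4 : v.adicCompletion K) with hγ
  have hγ0 : γ ≠ 0 := (Valuation.ne_zero_iff _).2 h40
  have hγ1 : γ ≤ 1 := by
    have := (4 : v.adicCompletionIntegers K).2
    exact this
  -- approximate `r` by an element of `K`
  obtain ⟨k, hk⟩ : ∃ k : K, Valued.v ((r : v.adicCompletion K) - algebraMap K _ k) < γ := by
    have ho : IsOpen {y : v.adicCompletion K | Valued.v ((r : v.adicCompletion K) - y) < γ} := by
      have := (Valued.isOpen_ball (v.adicCompletion K) (Valued.v.restrict 4)).preimage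
        ((continuous_const (y := (r : v.adicCompletion K))).sub continuous_id)
      simp only [Valuation.restrict_lt_iff] at this
      exact this
    exact (HeightOneSpectrum.denseRange_algebraMap K v).exists_mem_open ho
      ⟨r, by simpa [zero_lt_iff] using hγ0⟩
  have hvk : ∀ k : K, Valued.v (algebraMap K (v.adicCompletion K) k) = v.valuation K k :=
    fun k => HeightOneSpectrum.valuedAdicCompletion_eq_valuation' v k
  have hk1 : v.valuation K k ≤ 1 := by
    rw [← hvk]
    have := Valued.v.map_sub (r : v.adicCompletion K) (r - algebraMap K _ k)
    rw [sub_sub_cancel] at this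
    exact this.trans (max_le r.2 (hk.le.trans hγ1))
  obtain ⟨a, ha⟩ := v.exists_valuation_sub_lt_of_integer hk1 (Units.mk0 γ hγ0)
  rw [Units.val_mk0] at ha
  set q : 𝓞 K ⧸ I := Ideal.Quotient.mk I a
  obtain ⟨b, hb, hab⟩ : ∃ b ∈ v.asIdeal, 4 * b = a - q.out := by
    rw [← Ideal.mem_span_singleton_mul, ← hI, ← Ideal.Quotient.eq]
    exact (Ideal.Quotient.mk_out q).symm
  have hb1 : v.valuation K (algebraMap (𝓞 K) K b) < 1 := (v.valuation_lt_one_iff_mem b).2 hb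
  -- `r - q.out = 4 t` with `t` in the maximal ideal
  set c : v.adicCompletion K := algebraMap K _ (algebraMap (𝓞 K) K q.out) with hc
  have hc' : Valued.v ((r : v.adicCompletion K) - c) < γ := by
    have e : (r : v.adicCompletion K) - c = (r - algebraMap K _ k)
        + (- algebraMap K _ (algebraMap (𝓞 K) K a - k) +
          4 * algebraMap K _ (algebraMap (𝓞 K) K b)) := by
      have : algebraMap K (v.adicCompletion K) (algebraMap (𝓞 K) K (4 * b)) =
        algebraMap K (v.adicCompletion K) (algebraMap (𝓞 K) K (a - q.out)) := by rw [hab]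
      simp only [map_mul, map_sub, map_ofNat] at this ⊢
      rw [this]; ring
    rw [e]
    refine Valuation.map_add_lt _ hk (Valuation.map_add_lt _ ?_ ?_)
    · rw [Valuation.map_neg, hvk]; exact ha
    · rw [map_mul, hvk, ← hγ]
      exact mul_lt_of_lt_one_right (zero_lt_iff.2 hγ0) hb1
  obtain ⟨t, ht⟩ : ∃ t : v.adicCompletion K, (r : v.adicCompletion K) - c = 4 * t :=
    ⟨((r : v.adicCompletion K) - c) / 4, by field_simp⟩
  have ht1 : Valued.v t < 1 := by
    rw [ht, map_mul, ← hγ] at hc'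
    by_contra hcon
    exact absurd hc' (not_lt.2 (le_mul_of_one_le_right' (not_lt.1 hcon)))
  let T : v.adicCompletionIntegers K := ⟨t, ht1.le⟩
  have hp : IsUnit (1 + T) :=
    HeightOneSpectrum.adicCompletionIntegers.isUnit_iff_valued_eq_one.2
      (Valuation.map_one_add_of_lt _ ht1)
  have hm : IsUnit (1 - T) :=
    HeightOneSpectrum.adicCompletionIntegers.isUnit_iff_valued_eq_one.2
      (Valuation.map_one_sub_of_lt _ ht1)
  refine ⟨hp.unit, hm.unit, _, ⟨q, rfl⟩, ?_⟩
  have hr : r - algebraMap (𝓞 K) (v.adicCompletionIntegers K) q.out = 4 * T :=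
    Subtype.ext ht
  simp only [IsUnit.unit_spec]
  linear_combination hr

theorem sLemma_finite_bad (K : Type*) [Field K] [NumberField K] :
    {v : HeightOneSpectrum (𝓞 K) | ¬ IsUnit (30 : v.adicCompletionIntegers K)}.Finite := by
  have h0 : (Ideal.span {(30 : 𝓞 K)}) ≠ 0 := by simp
  refine (Ideal.finite_factors h0).subset fun v hv => ?_
  rw [Set.mem_ofPred_eq] at hv ⊢
  rw [← HeightOneSpectrum.valuation_lt_one_iff_dvd (K := K)]
  refine lt_of_le_of_ne (v.valuation_le_one _) fun h => hv ?_
  rw [HeightOneSpectrum.adicCompletionIntegers.isUnit_iff_valued_eq_one, ← h,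
    ← HeightOneSpectrum.valuedAdicCompletion_eq_valuation']
  congr 1
  change (30 : v.adicCompletion K) =
    algebraMap K (v.adicCompletion K) (algebraMap (𝓞 K) K 30)
  rw [map_ofNat (algebraMap (𝓞 K) K), map_ofNat]

/-- **S-lemma** for `R = ∏_{v ∈ P} O_v`: there is a finite subset `S` of `R` such that
every element of `R` is of the form `ξ² − η² + s` with `ξ, η ∈ Rˣ` and `s ∈ S`. -/
theorem S_lemma_prod_adicCompletionIntegers
    (K : Type*) [Field K] [NumberField K]
    (P : Set (HeightOneSpectrum (𝓞 K))) (hP : P.Nonempty) :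
    ∃ S : Finset (Π v : P, ((v : HeightOneSpectrum (𝓞 K)).adicCompletionIntegers K)),
      ∀ r : (Π v : P, ((v : HeightOneSpectrum (𝓞 K)).adicCompletionIntegers K)),
        ∃ (ξ η : (Π v : P, ((v : HeightOneSpectrum (𝓞 K)).adicCompletionIntegers K))ˣ),
          ∃ s ∈ S, r = (↑ξ) ^ 2 - (↑η) ^ 2 + s := by
  classical
  choose S hSf hS using sLemma_bad K
  let B : Set P := {v | ¬ IsUnit (30 : (v : HeightOneSpectrum (𝓞 K)).adicCompletionIntegers K)}
  have hB : B.Finite := (sLemma_finite_bad K).preimage Subtype.val_injective.injOn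
  have : Finite B := hB
  -- extension by zero of a family on the bad places
  let E : (Π v : B, ((v : P) : HeightOneSpectrum (𝓞 K)).adicCompletionIntegers K) →
      (Π v : P, ((v : HeightOneSpectrum (𝓞 K)).adicCompletionIntegers K)) :=
    fun f v => if h : v ∈ B then f ⟨v, h⟩ else 0
  have hfin : (E '' (Set.univ.pi fun v : B => S v)).Finite :=
    (Set.Finite.pi fun v : B => hSf v).image E
  refine ⟨hfin.toFinset, fun r => ?_⟩
  have key : ∀ v : P, ∃ x y : ((v : HeightOneSpectrum (𝓞 K)).adicCompletionIntegers K)ˣ,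
      ∃ s : (v : HeightOneSpectrum (𝓞 K)).adicCompletionIntegers K,
        (v ∈ B → s ∈ S v) ∧ (v ∉ B → s = 0) ∧ r v = (x : _) ^ 2 - (y : _) ^ 2 + s := by
    intro v
    by_cases hv : v ∈ B
    · obtain ⟨x, y, s, hs, h⟩ := hS v (r v)
      exact ⟨x, y, s, fun _ => hs, fun h' => absurd hv h', h⟩
    · obtain ⟨x, y, h⟩ := sLemma_good (not_not.1 hv) (r v)
      exact ⟨x, y, 0, fun h' => absurd h' hv, fun _ => rfl, by rw [add_zero]; exact h⟩
  choose x y s h1 h2 h3 using key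
  refine ⟨MulEquiv.piUnits.symm x, MulEquiv.piUnits.symm y, s, ?_, ?_⟩
  · rw [Set.Finite.mem_toFinset]
    refine ⟨fun v => s v, fun v _ => h1 v v.2, ?_⟩
    funext v
    by_cases hv : v ∈ B
    · simp [E, hv]
    · simp [E, hv, h2 v hv]
  · funext v
    exact h3 v
end

section
/- Let F be a field with char(F) ≠ 2 such that F has more than 5 elements (in particular any infinite such field). Then every element a of F can be written as a = x² − y² with x ≠ 0 and y ≠ 0. -/
/-- In any field of characteristic not `2` with more than `5` elements, every element
is a difference of two non-zero squares. -/
theorem diff_of_nonzero_squares (F : Type*) [Field F]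
    (hchar : ringChar F ≠ 2) (hcard : 5 < Cardinal.mk F) :
    ∀ a : F, ∃ x y : F, x ≠ 0 ∧ y ≠ 0 ∧ a = x ^ 2 - y ^ 2 := by
  intro a
  have h2 : (2 : F) ≠ 0 := Ring.two_ne_zero hchar
  obtain ⟨t, ht⟩ : ∃ t : F, t ^ 5 - a ^ 2 * t ≠ 0 := by
    by_contra! h
    classical
    let p : Polynomial F := Polynomial.X ^ 5 - Polynomial.C (a ^ 2) * Polynomial.X
    have hd : p.natDegree = 5 := by
      simp only [p]
      compute_degree!
    have hp : p ≠ 0 := by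
      intro h0
      rw [h0] at hd
      simp at hd
    have hr : ∀ t : F, t ∈ p.roots.toFinset := by
      intro t
      rw [Multiset.mem_toFinset, Polynomial.mem_roots hp]
      simpa [p] using h t
    have hc : p.roots.toFinset.card ≤ 5 :=
      (Multiset.toFinset_card_le _).trans (hd ▸ p.card_roots')
    have hu : ((p.roots.toFinset : Finset F) : Set F) = Set.univ :=
      Set.eq_univ_of_forall fun t => hr t
    have hm : Cardinal.mk F = (p.roots.toFinset.card : Cardinal) := by
      rw [← Cardinal.mk_univ, ← hu]
      exact Cardinal.mk_coe_finset
    rw [hm] at hcard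
    have : 5 < p.roots.toFinset.card := by exact_mod_cast hcard
    omega
  have ht0 : t ≠ 0 := by
    rintro rfl
    simp at ht
  refine ⟨(t + a / t) / 2, (t - a / t) / 2, ?_, ?_, ?_⟩
  · intro h
    apply ht
    field_simp at h
    linear_combination t * (t ^ 2 - a) * h
  · intro h
    apply ht
    field_simp at h
    linear_combination t * (t ^ 2 + a) * h
  · field_simp
    ring
end

section
/- Let K be a number field, v a height-one prime of its ring of integers, and O_v the ring of v-adic integers. Suppose the residue field of O_v has odd cardinality greater than 5. Then every element a of O_v can be written as a = ξ² − η² with ξ, η units of O_v. -/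
open IsDedekindDomain NumberField

theorem exists_good_elt (F : Type*) [Field F] (h : 5 < Nat.card F) (b : F) :
    ∃ u : F, u ≠ 0 ∧ b + u ^ 2 ≠ 0 ∧ b - u ^ 2 ≠ 0 := by
  classical
  haveI : Finite F := Nat.finite_of_card_ne_zero (by omega)
  haveI := Fintype.ofFinite F
  by_contra! hc
  let p : Polynomial F := Polynomial.X ^ 4 - Polynomial.C (b ^ 2)
  have hp : p ≠ 0 := Polynomial.X_pow_sub_C_ne_zero (by norm_num) _
  have hd : p.natDegree = 4 := Polynomial.natDegree_X_pow_sub_C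
  have hsub : (Finset.univ : Finset F) ⊆ insert 0 p.roots.toFinset := by
    intro u _
    by_cases hu : u = 0
    · simp [hu]
    · have key : u ^ 4 - b ^ 2 = 0 := by
        by_cases h1 : b + u ^ 2 = 0
        · linear_combination (u ^ 2 - b) * h1
        · linear_combination (-(b + u ^ 2)) * hc u hu h1
      have : u ∈ p.roots := by
        rw [Polynomial.mem_roots hp]
        simpa [p, Polynomial.IsRoot] using key
      simp only [Finset.mem_insert, Multiset.mem_toFinset]
      exact Or.inr this
  have h1 := Finset.card_le_card hsub
  have h2 := Finset.card_insert_le (0 : F) p.roots.toFinset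
  have h3 := Multiset.toFinset_card_le p.roots
  have h4 := Polynomial.card_roots' p
  rw [Finset.card_univ, ← Nat.card_eq_fintype_card] at h1
  omega

theorem diff_of_unit_squares_local (R : Type*) [CommRing R] [IsLocalRing R]
    (hodd : Odd (Nat.card (IsLocalRing.ResidueField R)))
    (hcard : 5 < Nat.card (IsLocalRing.ResidueField R)) (a : R) :
    ∃ ξ η : Rˣ, a = (↑ξ) ^ 2 - (↑η) ^ 2 := by
  have hun : ∀ x : R, IsLocalRing.residue R x ≠ 0 → IsUnit x := fun x hx =>
    (IsLocalRing.residue_ne_zero_iff_isUnit x).1 hx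
  have h2 : IsUnit (2 : R) := by
    apply hun
    haveI : Finite (IsLocalRing.ResidueField R) := Nat.finite_of_card_ne_zero (by omega)
    haveI := Fintype.ofFinite (IsLocalRing.ResidueField R)
    rw [map_ofNat]
    apply Ring.two_ne_zero
    intro hch
    have := FiniteField.even_card_iff_char_two.1 hch
    rw [← Nat.card_eq_fintype_card] at this
    have := Nat.odd_iff.1 hodd
    omega
  obtain ⟨u', hu, hp, hm⟩ := exists_good_elt _ hcard (IsLocalRing.residue R a)
  obtain ⟨u, rfl⟩ := IsLocalRing.residue_surjective u'
  rw [← map_pow, ← map_add] at hp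
  rw [← map_pow, ← map_sub] at hm
  obtain ⟨w, hw⟩ := hun _ hu
  obtain ⟨p, hp⟩ := hun _ hp
  obtain ⟨m, hm⟩ := hun _ hm
  obtain ⟨t, ht⟩ := h2
  refine ⟨p * w⁻¹ * t⁻¹, m * w⁻¹ * t⁻¹, ?_⟩
  have e1 : u * (↑w⁻¹ : R) = 1 := by rw [← hw]; simp
  have e2 : 2 * (↑t⁻¹ : R) = 1 := by rw [← ht]; simp
  push_cast
  rw [hp, hm]
  generalize (↑w⁻¹ : R) = x at *
  generalize (↑t⁻¹ : R) = y at *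
  calc a = a * 1 ^ 2 * 1 ^ 2 := by ring
    _ = a * (u * x) ^ 2 * (2 * y) ^ 2 := by rw [e1, e2]
    _ = _ := by ring



/-- If the residue field of `O_v` has odd cardinality greater than `5`, then every element
of `O_v` is a difference of two unit squares. -/
theorem diff_of_unit_squares_adicCompletionIntegers
    (K : Type*) [Field K] [NumberField K] (v : HeightOneSpectrum (𝓞 K))
    (hodd : Odd (Nat.card (IsLocalRing.ResidueField (v.adicCompletionIntegers K))))
    (hcard : 5 < Nat.card (IsLocalRing.ResidueField (v.adicCompletionIntegers K))) :
    ∀ a : v.adicCompletionIntegers K, ∃ ξ η : (v.adicCompletionIntegers K)ˣ,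
      a = (↑ξ) ^ 2 - (↑η) ^ 2 := by
  exact diff_of_unit_squares_local _ hodd hcard
end

section
/- Let K be a number field, v a height-one prime of its ring of integers, and O_v the ring of v-adic integers. Suppose the residue field of O_v has cardinality 3 or 5. Then every element a of O_v can be written as a = ξ² − η² + s with ξ, η units of O_v and s ∈ {0, 1, −1}. -/
open IsDedekindDomain NumberField

/-- In a local ring with `2` a unit, if `1 + b` and `1 - b` are units, then `b` is a difference of
two squares of units. -/
theorem aux_diff_sq {R : Type*} [CommRing R] (b : R) (h2 : IsUnit (2 : R))
    (h1 : IsUnit (1 + b)) (h1' : IsUnit (1 - b)) :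
    ∃ ξ η : Rˣ, b = (ξ : R) ^ 2 - (η : R) ^ 2 := by
  obtain ⟨t, ht⟩ := h2
  obtain ⟨x, hx⟩ := h1
  obtain ⟨y, hy⟩ := h1'
  refine ⟨x * t⁻¹, y * t⁻¹, ?_⟩
  have h : (2 : R) * (t⁻¹ : Rˣ) = 1 := by rw [← ht]; simp
  push_cast
  rw [hx, hy]
  generalize ((t⁻¹ : Rˣ) : R) = u at h
  linear_combination (-b * (2 * u + 1)) * h

theorem aux_local {R : Type*} [CommRing R] [IsLocalRing R]
    (h2 : (2 : IsLocalRing.ResidueField R) ≠ 0) (a : R) :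
    ∃ ξ η : Rˣ, ∃ s ∈ ({0, 1, -1} : Set R), a = (ξ : R) ^ 2 - (η : R) ^ 2 + s := by
  have key : ∀ x : R, IsLocalRing.residue R x ≠ 0 → IsUnit x := fun x hx =>
    (IsLocalRing.residue_ne_zero_iff_isUnit x).1 hx
  have hu2 : IsUnit (2 : R) := key 2 (by rw [map_ofNat]; exact h2)
  have main : ∀ s ∈ ({0, 1, -1} : Set R), IsLocalRing.residue R (1 + (a - s)) ≠ 0 →
      IsLocalRing.residue R (1 - (a - s)) ≠ 0 →
      ∃ ξ η : Rˣ, ∃ s ∈ ({0, 1, -1} : Set R), a = (ξ : R) ^ 2 - (η : R) ^ 2 + s := by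
    intro s hs h h'
    obtain ⟨ξ, η, e⟩ := aux_diff_sq (a - s) hu2 (key _ h) (key _ h')
    exact ⟨ξ, η, s, hs, by rw [← e]; ring⟩
  by_cases ha : IsLocalRing.residue R a = 1
  · exact main 1 (by simp) (by simp [ha]) (by simp [ha])
  by_cases hb : IsLocalRing.residue R a = -1
  · exact main (-1) (by simp) (by simp [hb]) (by simp [hb])
  · refine main 0 (by simp) ?_ ?_
    · simp only [sub_zero, map_add, map_one]
      intro h
      exact hb (by linear_combination h)
    · simp only [sub_zero, map_sub, map_one]
      intro h
      exact ha (by linear_combination -h)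

theorem aux_two {F : Type*} [Field F] (h : Nat.card F = 3 ∨ Nat.card F = 5) : (2 : F) ≠ 0 := by
  have : Finite F := Nat.finite_of_card_ne_zero (by omega)
  have h0 : ((Nat.card F : ℕ) : F) = 0 := by
    have := card_nsmul_eq_zero' (G := F) (x := 1)
    simpa using this
  intro h2
  apply one_ne_zero (α := F)
  rcases h with h | h <;> rw [h] at h0 <;> push_cast at h0
  · linear_combination h0 - h2
  · linear_combination h0 - 2 * h2

/-- If the residue field of `O_v` has cardinality `3` or `5`, then every element of `O_v`
is of the form `ξ² − η² + s` with `ξ, η` units and `s ∈ {0, 1, −1}`. -/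
theorem S_lemma_residue_three_or_five
    (K : Type*) [Field K] [NumberField K] (v : HeightOneSpectrum (𝓞 K))
    (hcard : Nat.card (IsLocalRing.ResidueField (v.adicCompletionIntegers K)) = 3 ∨
             Nat.card (IsLocalRing.ResidueField (v.adicCompletionIntegers K)) = 5) :
    ∀ a : v.adicCompletionIntegers K, ∃ ξ η : (v.adicCompletionIntegers K)ˣ,
      ∃ s ∈ ({0, 1, -1} : Set (v.adicCompletionIntegers K)),
        a = (↑ξ) ^ 2 - (↑η) ^ 2 + s := by
  exact fun a => aux_local (aux_two hcard) a
end

section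
/- Every element a of the ring ℤ₂ of 2-adic integers can be written as a = ξ² − η² + s with ξ, η units of ℤ₂ and s ∈ {0, 1, 2, 3, 4, 5, 6, 7} (natural numbers regarded as elements of ℤ₂). -/
theorem isUnit_one_add_two_mul_aux (t : ℤ_[2]) : IsUnit (1 + 2 * t) := by
  have h2 : (2 : ℤ_[2]) ∈ nonunits ℤ_[2] := by
    have h := PadicInt.prime_p (p := 2)
    exact_mod_cast h.not_unit
  have h : -(2 * t) ∈ nonunits ℤ_[2] := by
    intro hu
    exact h2 (isUnit_of_mul_isUnit_left (y := t) (by simpa using hu.neg))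
  have := IsLocalRing.isUnit_one_sub_self_of_mem_nonunits _ h
  simpa using this

/-- Every `2`-adic integer is of the form `ξ² − η² + s` with `ξ, η ∈ ℤ₂ˣ` and
`s ∈ {0, 1, 2, 3, 4, 5, 6, 7}` (natural numbers regarded as elements of `ℤ₂`). -/
theorem S_lemma_padicInt_two :
    ∀ a : ℤ_[2], ∃ ξ η : ℤ_[2]ˣ, ∃ s ∈ Finset.range 8,
      a = (↑ξ) ^ 2 - (↑η) ^ 2 + (s : ℤ_[2]) := by
  intro a
  obtain ⟨t, ht⟩ := Ideal.mem_span_singleton.mp (PadicInt.appr_spec 3 a)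
  obtain ⟨x, hx⟩ := isUnit_one_add_two_mul_aux t
  obtain ⟨y, hy⟩ := isUnit_one_add_two_mul_aux (t - 1)
  refine ⟨x, y, a.appr 3, ?_, ?_⟩
  · have := PadicInt.appr_lt a 3
    simpa using this
  · rw [hx, hy]
    push_cast at ht
    linear_combination ht
end

section
/- Let R be a commutative ring, and let α, β, s, t ∈ R with α = ξ² − η² + s and β = ζ² − ρ² + t where ξ, η, ζ, ρ are units of R. Then in SL₂(R), with conjugation g^x := x⁻¹ g x, one has u(βα) = u(β)^{h(ξ)} · (u(β)^{h(η)})⁻¹ · u(s)^{h(ζ)} · (u(s)^{h(ρ)})⁻¹ · u(st). -/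
open Matrix

/-- `u(λ) = [[1, λ], [0, 1]]` in `SL₂(R)`. -/
def SL2.u (R : Type*) [CommRing R] (lam : R) : SpecialLinearGroup (Fin 2) R :=
  ⟨!![1, lam; 0, 1], by simp [Matrix.det_fin_two_of]⟩

/-- `h(λ) = [[λ⁻¹, 0], [0, λ]]` in `SL₂(R)`, for a unit `λ`. -/
def SL2.h (R : Type*) [CommRing R] (lam : Rˣ) : SpecialLinearGroup (Fin 2) R :=
  ⟨!![(↑lam⁻¹ : R), 0; 0, (lam : R)], by simp [Matrix.det_fin_two_of]⟩

/-- Conjugation `g^x = x⁻¹ g x`. -/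
def SL2.conj {R : Type*} [CommRing R] (g x : SpecialLinearGroup (Fin 2) R) :
    SpecialLinearGroup (Fin 2) R :=
  x⁻¹ * g * x

theorem SL2.u_mul_u (R : Type*) [CommRing R] (a b : R) :
    SL2.u R a * SL2.u R b = SL2.u R (a + b) := by
  apply Subtype.ext
  change (SL2.u R a).1 * (SL2.u R b).1 = _
  simp [SL2.u, add_comm]

theorem SL2.u_inv (R : Type*) [CommRing R] (a : R) :
    (SL2.u R a)⁻¹ = SL2.u R (-a) := by
  rw [inv_eq_iff_mul_eq_one, SL2.u_mul_u]
  apply Subtype.ext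
  simp [SL2.u, Matrix.one_fin_two]

theorem SL2.conj_u (R : Type*) [CommRing R] (a : R) (m : Rˣ) :
    SL2.conj (SL2.u R a) (SL2.h R m) = SL2.u R (a * (m : R) ^ 2) := by
  rw [SL2.conj, mul_assoc, inv_mul_eq_iff_eq_mul]
  apply Subtype.ext
  have h : (↑m⁻¹ : R) * (a * (m : R) ^ 2) = a * m := by
    linear_combination a * (m : R) * m.inv_mul
  change (SL2.u R a).1 * (SL2.h R m).1 = (SL2.h R m).1 * (SL2.u R (a * (m : R) ^ 2)).1
  simp [SL2.u, SL2.h, h]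

/-- If `α = ξ² − η² + s` and `β = ζ² − ρ² + t` with `ξ, η, ζ, ρ` units, then
`u(βα) = u(β)^{h(ξ)} · (u(β)^{h(η)})⁻¹ · u(s)^{h(ζ)} · (u(s)^{h(ρ)})⁻¹ · u(st)`. -/
theorem u_mul_formula (R : Type*) [CommRing R] (α β s t : R) (ξ η ζ ρ : Rˣ)
    (hα : α = (↑ξ) ^ 2 - (↑η) ^ 2 + s) (hβ : β = (↑ζ) ^ 2 - (↑ρ) ^ 2 + t) :
    SL2.u R (β * α) =
      SL2.conj (SL2.u R β) (SL2.h R ξ) * (SL2.conj (SL2.u R β) (SL2.h R η))⁻¹ *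
      SL2.conj (SL2.u R s) (SL2.h R ζ) * (SL2.conj (SL2.u R s) (SL2.h R ρ))⁻¹ *
      SL2.u R (s * t) := by
  simp only [SL2.conj_u, SL2.u_inv, SL2.u_mul_u]
  congr 1
  subst hα hβ
  ring
end

section
/- Let (D_i)_{i ∈ I} be a family of commutative integral domains each of characteristic different from 2, and let R = ∏_{i ∈ I} D_i. For x ∈ SL₂(R) (equivalently, a family (x_i) with x_i ∈ SL₂(D_i)), the following are equivalent: (a) for every i ∈ I, x_i ∈ {1, w}; (b) there exist r, s ∈ R with r² = r and s² = s such that x = u(r) · (w⁻¹ u(s) w) · u(r) and x⁴ = 1. -/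
open Matrix

/-- `v(λ) = [[1, 0], [−λ, 1]]` in `SL₂(R)`. -/
def SL2.v (R : Type*) [CommRing R] (lam : R) : SpecialLinearGroup (Fin 2) R :=
  ⟨!![1, 0; -lam, 1], by simp [Matrix.det_fin_two_of]⟩

/-- `w = u(1) v(1) u(1) = [[0, 1], [−1, 0]]` in `SL₂(R)`. -/
def SL2.w (R : Type*) [CommRing R] : SpecialLinearGroup (Fin 2) R :=
  SL2.u R 1 * SL2.v R 1 * SL2.u R 1

/-- Entries of `u(r) (w⁻¹ u(s) w) u(r)`. -/
theorem SL2.eq_prod_iff {R : Type*} [CommRing R] (x : SpecialLinearGroup (Fin 2) R) (r s : R) :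
    x = SL2.u _ r * ((SL2.w _)⁻¹ * SL2.u _ s * SL2.w _) * SL2.u _ r ↔
      ((x : Matrix (Fin 2) (Fin 2) R) 0 0 = 1 - r * s ∧ (x : Matrix (Fin 2) (Fin 2) R) 0 1 = 2 * r - r * r * s) ∧
      ((x : Matrix (Fin 2) (Fin 2) R) 1 0 = -s ∧ (x : Matrix (Fin 2) (Fin 2) R) 1 1 = 1 - r * s) := by
  have h : ((SL2.u _ r * ((SL2.w _)⁻¹ * SL2.u _ s * SL2.w _) * SL2.u _ r :
      SpecialLinearGroup (Fin 2) R) : Matrix (Fin 2) (Fin 2) R) =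
      !![1 - r * s, 2 * r - r * r * s; -s, 1 - r * s] := by
    have hu : ∀ t : R, (SL2.u R t : Matrix (Fin 2) (Fin 2) R) = !![1, t; 0, 1] := fun _ => rfl
    have hv : ∀ t : R, (SL2.v R t : Matrix (Fin 2) (Fin 2) R) = !![1, 0; -t, 1] := fun _ => rfl
    have hw : (SL2.w R : Matrix (Fin 2) (Fin 2) R) = !![0, 1; -1, 0] := by
      simp [SL2.w, Matrix.SpecialLinearGroup.coe_mul, hu, hv]
    simp only [Matrix.SpecialLinearGroup.coe_mul, Matrix.SpecialLinearGroup.coe_inv, hu, hw,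
      Matrix.adjugate_fin_two_of]
    ext i j
    fin_cases i <;> fin_cases j <;> simp <;> ring
  rw [Matrix.SpecialLinearGroup.ext_iff, h]
  simp [Fin.forall_fin_two]

/-- Entrywise form of `x ^ 4 = 1`. -/
theorem SL2.pow_four_iff {R : Type*} [CommRing R] (x : SpecialLinearGroup (Fin 2) R)
    (a b c d : R) (ha : (x : Matrix (Fin 2) (Fin 2) R) 0 0 = a) (hb : (x : Matrix (Fin 2) (Fin 2) R) 0 1 = b) (hc : (x : Matrix (Fin 2) (Fin 2) R) 1 0 = c) (hd : (x : Matrix (Fin 2) (Fin 2) R) 1 1 = d) :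
    x ^ 4 = 1 ↔
      ((a * a + b * c) * (a * a + b * c) + (a * b + b * d) * (c * a + d * c) = 1 ∧
       (a * a + b * c) * (a * b + b * d) + (a * b + b * d) * (c * b + d * d) = 0) ∧
      ((c * a + d * c) * (a * a + b * c) + (c * b + d * d) * (c * a + d * c) = 0 ∧
       (c * a + d * c) * (a * b + b * d) + (c * b + d * d) * (c * b + d * d) = 1) := by
  have e : x ^ 4 = (x * x) * (x * x) := by
    rw [← pow_two, ← pow_two, ← pow_mul]
  subst ha hb hc hd
  rw [e, Matrix.SpecialLinearGroup.ext_iff]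
  simp [Fin.forall_fin_two, Matrix.mul_apply, Fin.sum_univ_two]

/-- Characterization of the set `W`: over a product `R = ∏ᵢ Dᵢ` of integral domains of
characteristic `≠ 2`, an element `x ∈ SL₂(R)` has all components in `{1, w}` if and only if
`x = u(r) · (w⁻¹ u(s) w) · u(r)` for some idempotents `r, s ∈ R`, and `x⁴ = 1`. -/
theorem mem_W_iff {I : Type*} (D : I → Type*)
    [∀ i, CommRing (D i)] [∀ i, IsDomain (D i)] (hchar : ∀ i, ringChar (D i) ≠ 2)
    (x : SpecialLinearGroup (Fin 2) (Π i, D i)) :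
    (∀ i, (Matrix.of fun k l => (x : Matrix (Fin 2) (Fin 2) (Π i, D i)) k l i) =
            (1 : Matrix (Fin 2) (Fin 2) (D i)) ∨
          (Matrix.of fun k l => (x : Matrix (Fin 2) (Fin 2) (Π i, D i)) k l i) =
            !![0, 1; -1, 0]) ↔
    (∃ r s : Π i, D i, r ^ 2 = r ∧ s ^ 2 = s ∧
        x = SL2.u _ r * ((SL2.w _)⁻¹ * SL2.u _ s * SL2.w _) * SL2.u _ r ∧
        x ^ 4 = 1) := by
  have key : ∀ i, (2 : D i) ≠ 0 := fun i => Ring.two_ne_zero (hchar i)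
  constructor
  · intro h
    have h' : ∀ i, ((x : Matrix (Fin 2) (Fin 2) (Π i, D i)) 0 0 i = 1 ∧ (x : Matrix (Fin 2) (Fin 2) (Π i, D i)) 0 1 i = 0 ∧ (x : Matrix (Fin 2) (Fin 2) (Π i, D i)) 1 0 i = 0 ∧ (x : Matrix (Fin 2) (Fin 2) (Π i, D i)) 1 1 i = 1) ∨
        ((x : Matrix (Fin 2) (Fin 2) (Π i, D i)) 0 0 i = 0 ∧ (x : Matrix (Fin 2) (Fin 2) (Π i, D i)) 0 1 i = 1 ∧ (x : Matrix (Fin 2) (Fin 2) (Π i, D i)) 1 0 i = -1 ∧ (x : Matrix (Fin 2) (Fin 2) (Π i, D i)) 1 1 i = 0) := by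
      intro i
      rcases h i with h | h
      · left
        have := fun k l => congrFun (congrFun h k) l
        exact ⟨by simpa using this 0 0, by simpa using this 0 1, by simpa using this 1 0,
          by simpa using this 1 1⟩
      · right
        have := fun k l => congrFun (congrFun h k) l
        exact ⟨by simpa using this 0 0, by simpa using this 0 1, by simpa using this 1 0,
          by simpa using this 1 1⟩
    refine ⟨-(x : Matrix (Fin 2) (Fin 2) (Π i, D i)) 1 0, -(x : Matrix (Fin 2) (Fin 2) (Π i, D i)) 1 0, ?_, ?_, ?_, ?_⟩
    · funext i
      rcases h' i with ⟨h1, h2, h3, h4⟩ | ⟨h1, h2, h3, h4⟩ <;> simp [h3]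
    · funext i
      rcases h' i with ⟨h1, h2, h3, h4⟩ | ⟨h1, h2, h3, h4⟩ <;> simp [h3]
    · rw [SL2.eq_prod_iff]
      refine ⟨⟨?_, ?_⟩, ?_, ?_⟩ <;> funext i <;>
      rcases h' i with ⟨h1, h2, h3, h4⟩ | ⟨h1, h2, h3, h4⟩ <;>
        simp [h1, h2, h3, h4] <;> norm_num
    · rw [SL2.pow_four_iff x _ _ _ _ rfl rfl rfl rfl]
      refine ⟨⟨?_, ?_⟩, ?_, ?_⟩ <;> funext i <;>
      rcases h' i with ⟨h1, h2, h3, h4⟩ | ⟨h1, h2, h3, h4⟩ <;>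
        simp [h1, h2, h3, h4]
  · rintro ⟨r, s, hr, hs, hx, h4⟩ i
    rw [SL2.eq_prod_iff] at hx
    obtain ⟨⟨ha, hb⟩, hc, hd⟩ := hx
    rw [SL2.pow_four_iff x _ _ _ _ ha hb hc hd] at h4
    obtain ⟨⟨-, p2⟩, p3, -⟩ := h4
    have hr' : r i = 0 ∨ r i = 1 := by
      have : r i ^ 2 = r i := congrFun hr i
      have : r i * (r i - 1) = 0 := by linear_combination this
      rcases mul_eq_zero.mp this with h | h
      · exact Or.inl h
      · exact Or.inr (sub_eq_zero.mp h)
    have hs' : s i = 0 ∨ s i = 1 := by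
      have : s i ^ 2 = s i := congrFun hs i
      have : s i * (s i - 1) = 0 := by linear_combination this
      rcases mul_eq_zero.mp this with h | h
      · exact Or.inl h
      · exact Or.inr (sub_eq_zero.mp h)
    have q2 := congrFun p2 i
    have q3 := congrFun p3 i
    have ha' := congrFun ha i
    have hb' := congrFun hb i
    have hc' := congrFun hc i
    have hd' := congrFun hd i
    have t2 : (2 : (Π i, D i)) i = 2 := rfl
    simp only [Pi.add_apply, Pi.mul_apply, Pi.sub_apply, Pi.neg_apply, Pi.one_apply,
      Pi.zero_apply, t2] at q2 q3 ha' hb' hc' hd'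
    rcases hr' with h0 | h0 <;> rcases hs' with h1 | h1 <;>
      rw [h0, h1] at q2 q3 ha' hb' hd' <;> rw [h1] at hc'
    · left
      ext k l
      fin_cases k <;> fin_cases l <;> simp [ha', hb', hc', hd']
    · exfalso
      have : (2 : D i) ^ 2 = 0 := by linear_combination -q3
      exact key i (pow_eq_zero_iff (two_ne_zero) |>.mp this)
    · exfalso
      have : (2 : D i) ^ 3 = 0 := by linear_combination q2
      exact key i (pow_eq_zero_iff (three_ne_zero) |>.mp this)
    · right
      ext k l
      fin_cases k <;> fin_cases l <;> simp [ha', hb', hc', hd'] <;> norm_num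
end

section
/- Let (L_i)_{i ∈ I} be a family of commutative local rings and R = ∏_{i ∈ I} L_i. Then every element g of SL₂(R) can be written as a product of eight alternating elementary matrices: g = v(a₁) u(b₁) v(a₂) u(b₂) v(a₃) u(b₃) v(a₄) u(b₄) for some a₁,…,a₄, b₁,…,b₄ ∈ R. -/
open Matrix

theorem SL2.coe_u (R : Type*) [CommRing R] (x : R) :
    (SL2.u R x : Matrix (Fin 2) (Fin 2) R) = !![1, x; 0, 1] := rfl

theorem SL2.coe_v (R : Type*) [CommRing R] (x : R) :
    (SL2.v R x : Matrix (Fin 2) (Fin 2) R) = !![1, 0; -x, 1] := rfl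

theorem eight_aux {R : Type*} [CommRing R] (g : SpecialLinearGroup (Fin 2) R)
    (A B C D t e : R) (hg : (g : Matrix (Fin 2) (Fin 2) R) = !![A, B; C, D])
    (hdet : A * D - B * C = 1) (he : e * (B - A * t) = 1) :
    g = SL2.v _ ((1 - (D - C * t)) * e) * SL2.u _ (B - A * t) * SL2.v _ ((1 - A) * e) *
      SL2.u _ t * SL2.v _ 0 * SL2.u _ 0 * SL2.v _ 0 * SL2.u _ 0 := by
  apply Matrix.SpecialLinearGroup.ext
  rw [hg]
  simp only [Matrix.SpecialLinearGroup.coe_mul, SL2.coe_u, SL2.coe_v, Matrix.mul_fin_two]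
  intro i j
  fin_cases i <;> fin_cases j <;> simp <;> grind

/-- Over a product `R = ∏ᵢ Lᵢ` of local rings, every element of `SL₂(R)` is a product of
eight alternating elementary matrices `v(a₁) u(b₁) v(a₂) u(b₂) v(a₃) u(b₃) v(a₄) u(b₄)`. -/
theorem eq_prod_eight_elementary {I : Type*} (L : I → Type*)
    [∀ i, CommRing (L i)] [∀ i, IsLocalRing (L i)]
    (g : SpecialLinearGroup (Fin 2) (Π i, L i)) :
    ∃ a₁ b₁ a₂ b₂ a₃ b₃ a₄ b₄ : Π i, L i,
      g = SL2.v _ a₁ * SL2.u _ b₁ * SL2.v _ a₂ * SL2.u _ b₂ *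
          SL2.v _ a₃ * SL2.u _ b₃ * SL2.v _ a₄ * SL2.u _ b₄ := by
  have hdet : g 0 0 * g 1 1 - g 0 1 * g 1 0 = 1 := by
    have h := g.det_coe
    rwa [Matrix.det_fin_two] at h
  have key : ∀ i, ∃ t e : L i, e * (g 0 1 i - g 0 0 i * t) = 1 := by
    intro i
    have h1 : g 0 0 i * g 1 1 i + -(g 0 1 i * g 1 0 i) = 1 := by
      have h := congrFun hdet i
      simpa [sub_eq_add_neg] using h
    by_cases hb : IsUnit (g 0 1 i)
    · obtain ⟨e, he⟩ := hb.exists_left_inv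
      exact ⟨0, e, by simpa using he⟩
    · have ha : IsUnit (g 0 0 i) := by
        rcases IsLocalRing.isUnit_or_isUnit_of_add_one h1 with h | h
        · exact isUnit_of_mul_isUnit_left h
        · rw [IsUnit.neg_iff] at h
          exact absurd (isUnit_of_mul_isUnit_left h) hb
      have hu : IsUnit (g 0 1 i - g 0 0 i) := by
        by_contra hn
        have h2 := IsLocalRing.nonunits_add (a := g 0 1 i) (b := -(g 0 1 i - g 0 0 i)) hb
          (by rwa [mem_nonunits_iff, IsUnit.neg_iff])
        apply h2
        simpa using ha
      obtain ⟨e, he⟩ := hu.exists_left_inv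
      exact ⟨1, e, by simpa using he⟩
  choose t e hte using key
  have he : e * (g 0 1 - g 0 0 * t) = 1 := funext hte
  refine ⟨(1 - (g 1 1 - g 1 0 * t)) * e, g 0 1 - g 0 0 * t, (1 - g 0 0) * e, t, 0, 0, 0, 0, ?_⟩
  generalize hA : g 0 0 = A at *
  generalize hB : g 0 1 = B at *
  generalize hC : g 1 0 = C at *
  generalize hD : g 1 1 = D at *
  have hg : (g : Matrix (Fin 2) (Fin 2) (Π i, L i)) = !![A, B; C, D] := by
    rw [← hA, ← hB, ← hC, ← hD]
    exact Matrix.eta_fin_two _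
  exact eight_aux g A B C D t e hg hdet he
end

section
/- Let (D_i)_{i ∈ I} be a nonempty family of commutative integral domains and R = ∏_{i ∈ I} D_i. Then the centre of the centralizer of u(1) in SL₂(R) equals { z · u(r) : r ∈ R, z ∈ R with z² = 1 }, where z·u(r) denotes the scalar matrix [[z, 0],[0, z]] times u(r); equivalently, it equals u(R) · Z, Z being the centre { [[z,0],[0,z]] : z² = 1 } of SL₂(R). Explicitly: g ∈ SL₂(R) commutes with every element of SL₂(R) that commutes with u(1) if and only if g = [[z, zr], [0, z]] for some r ∈ R and some z ∈ R with z² = 1. -/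
open Matrix

theorem SL2.comm_u_one {R : Type*} [CommRing R] (x : SpecialLinearGroup (Fin 2) R)
    (h : x * SL2.u _ 1 = SL2.u _ 1 * x) : x.1 1 0 = 0 ∧ x.1 0 0 = x.1 1 1 := by
  have h' : x.1 * !![1, 1; 0, 1] = !![1, 1; 0, 1] * x.1 := congrArg Subtype.val h
  have h00 := congrFun (congrFun h' 0) 0
  have h01 := congrFun (congrFun h' 0) 1
  simp [Matrix.mul_apply, Fin.sum_univ_two] at h00 h01
  refine ⟨h00, ?_⟩
  linear_combination h01

/-- Over a product `R = ∏ᵢ Dᵢ` of a nonempty family of integral domains, the centre of the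
centralizer of `u(1)` in `SL₂(R)` is `u(R)·Z`: explicitly, `g` commutes with every element
of `SL₂(R)` commuting with `u(1)` iff `g = [[z, zr], [0, z]]` for some `r, z ∈ R` with
`z² = 1`. -/
theorem center_centralizer_u_one {I : Type*} [Nonempty I] (D : I → Type*)
    [∀ i, CommRing (D i)] [∀ i, IsDomain (D i)]
    (g : SpecialLinearGroup (Fin 2) (Π i, D i)) :
    (∀ x : SpecialLinearGroup (Fin 2) (Π i, D i),
        x * SL2.u _ 1 = SL2.u _ 1 * x → g * x = x * g) ↔
    ∃ r z : Π i, D i, z ^ 2 = 1 ∧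
      (g : Matrix (Fin 2) (Fin 2) (Π i, D i)) = !![z, z * r; 0, z] := by
  constructor
  · intro h
    obtain ⟨hc, ha⟩ := SL2.comm_u_one g (h _ rfl)
    have hd : g.1.det = 1 := g.2
    rw [Matrix.det_fin_two, hc, ← ha] at hd
    have hz : g.1 0 0 ^ 2 = 1 := by linear_combination hd
    refine ⟨g.1 0 0 * g.1 0 1, g.1 0 0, hz, ?_⟩
    have hb : g.1 0 0 * (g.1 0 0 * g.1 0 1) = g.1 0 1 := by
      linear_combination g.1 0 1 * hz
    rw [hb]
    refine (Matrix.eta_fin_two g.1).trans ?_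
    rw [hc, ← ha]
  · rintro ⟨r, z, -, hg⟩ x hx
    obtain ⟨hc, ha⟩ := SL2.comm_u_one x hx
    apply Subtype.ext
    change g.1 * x.1 = x.1 * g.1
    have hx' := Matrix.eta_fin_two x.1
    rw [hc, ← ha] at hx'
    rw [show g.1 = _ from hg, hx', Matrix.mul_fin_two, Matrix.mul_fin_two]
    congr! 4 <;> ring_nf
end
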